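/- Decompose ℝⁿ = ℝ^{n₁} × ⋯ × ℝ^{n_k} with n₁ + ⋯ + n_k = n and each nᵢ ≥ 1, and let a, b ∈ ℝᵏ with 0 < aᵢ ≤ bᵢ < ∞ for all i. For every ε > 0 there exists f ∈ L¹(ℝⁿ) with ‖f‖_{L¹(ℝⁿ)} = 1 such that ‖M̃_a^b f‖_{L¹(ℝⁿ)} ≥ ∏_{i=1}^k (1 + nᵢ·ln(bᵢ/aᵢ)) − ε. Consequently the operator norm of M̃_a^b on L¹(ℝⁿ) equals ∏_{i=1}^k (1 + nᵢ·ln(bᵢ/aᵢ)). -/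

import Mathlib

open MeasureTheory Metric Set ENNReal NNReal

/-- The general strong truncated Hardy–Littlewood maximal operator on
`ℝⁿ = ℝ^{n₁} × ⋯ × ℝ^{n_k}`:
`M̃_a^b f(x) = sup_{aᵢ ≤ rᵢ ≤ bᵢ} (1/∏ᵢ|B(xᵢ,rᵢ)|) ∫_{∏ᵢ B(xᵢ,rᵢ)} |f(y)| dy`. -/
noncomputable def genTruncMax (k : ℕ) (n : Fin k → ℕ) (a b : Fin k → ℝ)
    (f : (∀ i, EuclideanSpace ℝ (Fin (n i))) → ℝ)
    (x : ∀ i, EuclideanSpace ℝ (Fin (n i))) : ℝ≥0∞ :=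
  ⨆ (r : Fin k → ℝ) (_ : ∀ i, r i ∈ Set.Icc (a i) (b i)),
    (volume (Set.univ.pi fun i => Metric.ball (x i) (r i)))⁻¹ *
      ∫⁻ y in Set.univ.pi fun i => Metric.ball (x i) (r i), (‖f y‖₊ : ℝ≥0∞)

/-- The radial kernel on `ℝᵈ` equal to `1/|B(0, max(a, |z| + δ))|` on `|z| + δ < b` and to `0`
elsewhere. -/
noncomputable def truncKernel (d : ℕ) (a b δ : ℝ) (z : EuclideanSpace ℝ (Fin d)) : ℝ :=
  if ‖z‖ + δ < b then (volume.real (ball (0 : EuclideanSpace ℝ (Fin d)) (max a (‖z‖ + δ))))⁻¹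
  else 0

section Kernel

variable {d : ℕ} {a b δ : ℝ}

lemma volume_real_ball_eq_pow_mul {r : ℝ} (hr : 0 < r) :
    volume.real (ball (0 : EuclideanSpace ℝ (Fin d)) r) =
      r ^ d * volume.real (ball (0 : EuclideanSpace ℝ (Fin d)) 1) := by
  rw [Measure.real, Measure.addHaar_ball_of_pos _ _ hr, ENNReal.toReal_mul,
    ENNReal.toReal_ofReal (by positivity), finrank_euclideanSpace_fin, Measure.real]

lemma volume_real_ball_pos {r : ℝ} (hr : 0 < r) :
    0 < volume.real (ball (0 : EuclideanSpace ℝ (Fin d)) r) :=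
  ENNReal.toReal_pos (measure_ball_pos _ _ hr).ne' measure_ball_lt_top.ne

lemma truncKernel_nonneg (z : EuclideanSpace ℝ (Fin d)) : 0 ≤ truncKernel d a b δ z := by
  unfold truncKernel
  split_ifs <;> positivity

lemma truncKernel_eq_pow_mul (ha : 0 < a) (z : EuclideanSpace ℝ (Fin d)) :
    truncKernel d a b δ z = if ‖z‖ + δ < b then
      (max a (‖z‖ + δ) ^ d * volume.real (ball (0 : EuclideanSpace ℝ (Fin d)) 1))⁻¹ else 0 := by
  rw [truncKernel, volume_real_ball_eq_pow_mul (lt_max_of_lt_left ha)]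

lemma measurable_truncKernel (ha : 0 < a) : Measurable (truncKernel d a b δ) := by
  rw [funext (truncKernel_eq_pow_mul ha)]
  refine Measurable.ite (measurableSet_lt (by fun_prop) (by fun_prop)) ?_ measurable_const
  fun_prop

lemma truncKernel_le_indicator (ha : 0 < a) (hδ : 0 ≤ δ) (z : EuclideanSpace ℝ (Fin d)) :
    truncKernel d a b δ z ≤ (ball (0 : EuclideanSpace ℝ (Fin d)) b).indicator
      (fun _ ↦ (volume.real (ball (0 : EuclideanSpace ℝ (Fin d)) a))⁻¹) z := by
  have hpos := volume_real_ball_pos (d := d) ha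
  unfold truncKernel
  split_ifs with h
  · rw [indicator_of_mem (by rw [mem_ball_zero_iff]; linarith)]
    exact inv_anti₀ hpos (measureReal_mono (ball_subset_ball (le_max_left _ _))
      measure_ball_lt_top.ne)
  · exact indicator_nonneg (fun _ _ ↦ by positivity) _

lemma integrable_ball_indicator_const (c : ℝ) :
    Integrable ((ball (0 : EuclideanSpace ℝ (Fin d)) b).indicator fun _ ↦ c) :=
  (integrable_indicator_iff measurableSet_ball).2 (integrableOn_const measure_ball_lt_top.ne)

lemma integrable_truncKernel (ha : 0 < a) (hδ : 0 ≤ δ) : Integrable (truncKernel d a b δ) := by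
  refine (integrable_ball_indicator_const (b := b)
    (volume.real (ball (0 : EuclideanSpace ℝ (Fin d)) a))⁻¹).mono'
    (measurable_truncKernel ha).aestronglyMeasurable (Filter.Eventually.of_forall fun z ↦ ?_)
  rw [Real.norm_of_nonneg (truncKernel_nonneg z)]
  exact truncKernel_le_indicator ha hδ z

lemma integral_truncKernel_zero (hd : 1 ≤ d) (ha : 0 < a) (hab : a ≤ b) :
    ∫ z, truncKernel d a b 0 z = 1 + d * Real.log (b / a) := by
  have : Nonempty (Fin d) := ⟨⟨0, hd⟩⟩
  have hb : 0 < b := ha.trans_le hab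
  set c := volume.real (ball (0 : EuclideanSpace ℝ (Fin d)) 1) with hc
  have hcpos : 0 < c := volume_real_ball_pos one_pos
  have hd0 : (d : ℝ) ≠ 0 := by positivity
  have hsub : ((d - 1 : ℕ) : ℝ) + 1 = d := by exact_mod_cast Nat.sub_add_cancel hd
  have hradial (z : EuclideanSpace ℝ (Fin d)) : truncKernel d a b 0 z =
      (fun y : ℝ ↦ if y < b then (max a y ^ d * c)⁻¹ else 0) ‖z‖ := by
    simp [truncKernel_eq_pow_mul ha, hc]
  set F : ℝ → ℝ := fun y ↦ y ^ (d - 1) * (max a y ^ d * c)⁻¹ with hF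
  have hFcont : Continuous F := by
    refine (continuous_pow _).mul (Continuous.inv₀ (by fun_prop) fun y ↦ ?_)
    have : 0 < max a y := lt_max_of_lt_left ha
    positivity
  have hinner : ∫ y in (0 : ℝ)..a, F y = c⁻¹ / d := by
    calc ∫ y in (0 : ℝ)..a, F y = ∫ y in (0 : ℝ)..a, y ^ (d - 1) * (a ^ d * c)⁻¹ := by
          refine intervalIntegral.integral_congr fun y hy ↦ ?_
          rw [uIcc_of_le ha.le] at hy
          simp only [hF, max_eq_left hy.2]
      _ = c⁻¹ / d := by
          rw [intervalIntegral.integral_mul_const, integral_pow, Nat.sub_add_cancel hd, hsub,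
            zero_pow (by omega)]
          field_simp
          ring
  have houter : ∫ y in a..b, F y = c⁻¹ * Real.log (b / a) := by
    calc ∫ y in a..b, F y = ∫ y in a..b, c⁻¹ * y⁻¹ := by
          refine intervalIntegral.integral_congr fun y hy ↦ ?_
          rw [uIcc_of_le hab] at hy
          have hy0 : y ≠ 0 := (ha.trans_le hy.1).ne'
          simp only [hF, max_eq_right hy.1]
          nth_rw 2 [← Nat.sub_add_cancel hd]
          rw [pow_succ]
          field_simp
      _ = c⁻¹ * Real.log (b / a) := by
          rw [intervalIntegral.integral_const_mul, integral_inv_of_pos ha hb]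
  have htotal : ∫ y in Ioi (0 : ℝ), y ^ (d - 1) • (if y < b then (max a y ^ d * c)⁻¹ else 0) =
      c⁻¹ / d + c⁻¹ * Real.log (b / a) := by
    rw [← hinner, ← houter, intervalIntegral.integral_add_adjacent_intervals
      (hFcont.intervalIntegrable _ _) (hFcont.intervalIntegrable _ _),
      intervalIntegral.integral_of_le hb.le, integral_Ioc_eq_integral_Ioo,
      ← Ioi_inter_Iio, ← setIntegral_indicator measurableSet_Iio]
    congr 1 with y
    simp [indicator_apply, hF]
  simp_rw [hradial]
  rw [integral_fun_norm_addHaar volume fun y : ℝ ↦ if y < b then (max a y ^ d * c)⁻¹ else 0,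
    finrank_euclideanSpace_fin, htotal, ← hc, nsmul_eq_mul, smul_eq_mul]
  field_simp

open Filter Topology in
lemma tendsto_integral_truncKernel (ha : 0 < a) :
    Tendsto (fun δ ↦ ∫ z, truncKernel d a b δ z) (𝓝[>] 0) (𝓝 (∫ z, truncKernel d a b 0 z)) := by
  refine tendsto_integral_filter_of_dominated_convergence _
    (Eventually.of_forall fun δ ↦ (measurable_truncKernel ha).aestronglyMeasurable)
    ?_ (integrable_ball_indicator_const (b := b)
      (volume.real (ball (0 : EuclideanSpace ℝ (Fin d)) a))⁻¹) (Eventually.of_forall fun z ↦ ?_)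
  · filter_upwards [self_mem_nhdsWithin] with δ hδ
    refine Eventually.of_forall fun z ↦ ?_
    rw [Real.norm_of_nonneg (truncKernel_nonneg z)]
    exact truncKernel_le_indicator ha (le_of_lt hδ) z
  · have hcont : Continuous fun δ : ℝ ↦ ‖z‖ + δ := by fun_prop
    by_cases hz : ‖z‖ < b
    · refine Tendsto.mono_left ?_ nhdsWithin_le_nhds
      have hmem : ∀ᶠ δ : ℝ in 𝓝 0, ‖z‖ + δ < b :=
        hcont.continuousAt.eventually_lt continuousAt_const (by simpa)
      have hlim : ContinuousAt (fun δ ↦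
          (max a (‖z‖ + δ) ^ d * volume.real (ball (0 : EuclideanSpace ℝ (Fin d)) 1))⁻¹) 0 := by
        refine ContinuousAt.inv₀ (by fun_prop) ?_
        have h1 := volume_real_ball_pos (d := d) one_pos
        have h2 : 0 < max a (‖z‖ + 0) := lt_max_of_lt_left ha
        positivity
      rw [truncKernel_eq_pow_mul ha, if_pos (by simpa)]
      refine hlim.tendsto.congr' ?_
      filter_upwards [hmem] with δ hδ
      rw [truncKernel_eq_pow_mul ha, if_pos hδ]
    · rw [truncKernel, if_neg (by simpa using hz)]
      refine tendsto_const_nhds.congr' ?_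
      filter_upwards [self_mem_nhdsWithin] with δ (hδ : 0 < δ)
      rw [truncKernel, if_neg (by linarith)]

end Kernel

section Maximal

variable {k : ℕ} {n : Fin k → ℕ} {a b : Fin k → ℝ}

lemma lintegral_prod_truncKernel {δ : ℝ} (ha : ∀ i, 0 < a i) (hδ : 0 ≤ δ) :
    ∫⁻ x : (∀ i, EuclideanSpace ℝ (Fin (n i))),
      ENNReal.ofReal (∏ i, truncKernel (n i) (a i) (b i) δ (x i)) =
      ENNReal.ofReal (∏ i, ∫ z, truncKernel (n i) (a i) (b i) δ z) := by
  rw [← integral_fintype_prod_volume_eq_prod, ofReal_integral_eq_lintegral_ofReal]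
  · exact Integrable.fintype_prod_dep fun i ↦ integrable_truncKernel (ha i) hδ
  · exact Filter.Eventually.of_forall fun x ↦ Finset.prod_nonneg fun i _ ↦ truncKernel_nonneg _

lemma inv_volume_pi_ball (x : ∀ i, EuclideanSpace ℝ (Fin (n i))) {r : Fin k → ℝ}
    (hr : ∀ i, 0 < r i) :
    (volume (univ.pi fun i ↦ ball (x i) (r i)))⁻¹ =
      ENNReal.ofReal (∏ i, (volume.real (ball (0 : EuclideanSpace ℝ (Fin (n i))) (r i)))⁻¹) := by
  rw [volume_pi_pi, Finset.prod_inv_distrib,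
    ENNReal.ofReal_inv_of_pos (Finset.prod_pos fun i _ ↦ volume_real_ball_pos (hr i)),
    ENNReal.ofReal_prod_of_nonneg fun i _ ↦ measureReal_nonneg]
  congr 1
  refine Finset.prod_congr rfl fun i _ ↦ ?_
  rw [ofReal_measureReal measure_ball_lt_top.ne, Measure.addHaar_ball_center]

lemma genTruncMax_le_lintegral (ha : ∀ i, 0 < a i)
    (f : (∀ i, EuclideanSpace ℝ (Fin (n i))) → ℝ) (x : ∀ i, EuclideanSpace ℝ (Fin (n i))) :
    genTruncMax k n a b f x ≤
      ∫⁻ y, ENNReal.ofReal (∏ i, truncKernel (n i) (a i) (b i) 0 ((x - y) i)) * ‖f y‖₊ := by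
  refine iSup₂_le fun r hr ↦ ?_
  have hpos (i) : 0 < r i := (ha i).trans_le (hr i).1
  rw [inv_volume_pi_ball x hpos, ← lintegral_const_mul' _ _ ENNReal.ofReal_ne_top,
    ← lintegral_indicator (MeasurableSet.univ_pi fun i ↦ measurableSet_ball)]
  refine lintegral_mono (indicator_le fun y hy ↦ ?_)
  gcongr with i
  have hyi : ‖x i - y i‖ < r i := by
    rw [← dist_eq_norm, dist_comm]
    exact hy i (mem_univ i)
  rw [truncKernel, if_pos (by simpa using hyi.trans_le (hr i).2)]
  refine inv_anti₀ (volume_real_ball_pos (lt_max_of_lt_left (ha i)))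
    (measureReal_mono (ball_subset_ball (max_le (hr i).1 ?_)) measure_ball_lt_top.ne)
  simpa using hyi.le

lemma lintegral_genTruncMax_le (ha : ∀ i, 0 < a i)
    {f : (∀ i, EuclideanSpace ℝ (Fin (n i))) → ℝ} (hf : Integrable f) :
    ∫⁻ x, genTruncMax k n a b f x ≤
      ENNReal.ofReal (∏ i, ∫ z, truncKernel (n i) (a i) (b i) 0 z) * ∫⁻ x, (‖f x‖₊ : ℝ≥0∞) := by
  have hmeas : Measurable fun z : (∀ i, EuclideanSpace ℝ (Fin (n i))) ↦
      ENNReal.ofReal (∏ i, truncKernel (n i) (a i) (b i) 0 (z i)) :=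
    (Finset.measurable_prod _ fun i _ ↦
      (measurable_truncKernel (ha i)).comp (measurable_pi_apply i)).ennreal_ofReal
  have hfm : AEMeasurable (fun y ↦ (‖f y‖₊ : ℝ≥0∞)) := hf.aestronglyMeasurable.aemeasurable.enorm
  calc ∫⁻ x, genTruncMax k n a b f x
      ≤ ∫⁻ x, ∫⁻ y, ENNReal.ofReal (∏ i, truncKernel (n i) (a i) (b i) 0 ((x - y) i)) * ‖f y‖₊ :=
        lintegral_mono (genTruncMax_le_lintegral ha f)
    _ = ∫⁻ y, ∫⁻ x, ENNReal.ofReal (∏ i, truncKernel (n i) (a i) (b i) 0 ((x - y) i)) * ‖f y‖₊ :=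
        lintegral_lintegral_swap
          ((hmeas.comp (measurable_fst.sub measurable_snd)).aemeasurable.mul hfm.comp_snd)
    _ = ∫⁻ y, ENNReal.ofReal (∏ i, ∫ z, truncKernel (n i) (a i) (b i) 0 z) * ‖f y‖₊ := by
        refine lintegral_congr fun y ↦ ?_
        rw [lintegral_mul_const' _ _ ENNReal.coe_ne_top, lintegral_sub_right_eq_self (fun z ↦
          ENNReal.ofReal (∏ i, truncKernel (n i) (a i) (b i) 0 (z i))) y,
          lintegral_prod_truncKernel ha le_rfl]
    _ = _ := lintegral_const_mul' _ _ ENNReal.ofReal_ne_top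

/-- The `L¹`-normalised indicator of the product of the balls of radius `δ` about the origin. -/
noncomputable def bump (n : Fin k → ℕ) (δ : ℝ) : (∀ i, EuclideanSpace ℝ (Fin (n i))) → ℝ :=
  (univ.pi fun i ↦ ball (0 : EuclideanSpace ℝ (Fin (n i))) δ).indicator fun _ ↦
    (volume.real (univ.pi fun i ↦ ball (0 : EuclideanSpace ℝ (Fin (n i))) δ))⁻¹

lemma volume_pi_ball_ne_zero {δ : ℝ} (hδ : 0 < δ) :
    volume (univ.pi fun i ↦ ball (0 : EuclideanSpace ℝ (Fin (n i))) δ) ≠ 0 := by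
  rw [volume_pi_pi, Finset.prod_ne_zero_iff]
  exact fun i _ ↦ (measure_ball_pos _ _ hδ).ne'

lemma volume_pi_ball_ne_top {δ : ℝ} :
    volume (univ.pi fun i ↦ ball (0 : EuclideanSpace ℝ (Fin (n i))) δ) ≠ ∞ := by
  rw [volume_pi_pi]
  exact ENNReal.prod_ne_top fun i _ ↦ measure_ball_lt_top.ne

lemma measurableSet_pi_ball {δ : ℝ} :
    MeasurableSet (univ.pi fun i ↦ ball (0 : EuclideanSpace ℝ (Fin (n i))) δ) :=
  MeasurableSet.univ_pi fun _ ↦ measurableSet_ball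

lemma integrable_bump (δ : ℝ) : Integrable (bump n δ) :=
  (integrable_indicator_iff measurableSet_pi_ball).2 (integrableOn_const volume_pi_ball_ne_top)

lemma enorm_bump {δ : ℝ} (hδ : 0 < δ) (y : ∀ i, EuclideanSpace ℝ (Fin (n i))) :
    (‖bump n δ y‖₊ : ℝ≥0∞) = (univ.pi fun i ↦ ball (0 : EuclideanSpace ℝ (Fin (n i))) δ).indicator
      (fun _ ↦ (volume (univ.pi fun i ↦ ball (0 : EuclideanSpace ℝ (Fin (n i))) δ))⁻¹) y := by
  rw [← enorm_eq_nnnorm, bump, enorm_indicator_eq_indicator_enorm,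
    Real.enorm_of_nonneg (by positivity), Measure.real,
    ENNReal.ofReal_inv_of_pos (ENNReal.toReal_pos (volume_pi_ball_ne_zero hδ)
      volume_pi_ball_ne_top), ENNReal.ofReal_toReal volume_pi_ball_ne_top]

lemma setLIntegral_bump {δ : ℝ} (hδ : 0 < δ) {s : Set (∀ i, EuclideanSpace ℝ (Fin (n i)))}
    (hs : (univ.pi fun i ↦ ball (0 : EuclideanSpace ℝ (Fin (n i))) δ) ⊆ s) :
    ∫⁻ y in s, (‖bump n δ y‖₊ : ℝ≥0∞) = 1 := by
  simp_rw [enorm_bump hδ]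
  rw [lintegral_indicator_const measurableSet_pi_ball,
    Measure.restrict_apply measurableSet_pi_ball, inter_eq_left.2 hs,
    ENNReal.inv_mul_cancel (volume_pi_ball_ne_zero hδ) volume_pi_ball_ne_top]

lemma le_genTruncMax_bump (ha : ∀ i, 0 < a i) (hab : ∀ i, a i ≤ b i) {δ : ℝ} (hδ : 0 < δ)
    (x : ∀ i, EuclideanSpace ℝ (Fin (n i))) :
    ENNReal.ofReal (∏ i, truncKernel (n i) (a i) (b i) δ (x i)) ≤
      genTruncMax k n a b (bump n δ) x := by
  by_cases hx : ∀ i, ‖x i‖ + δ < b i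
  · refine le_trans (le_of_eq ?_) (le_iSup₂ (fun i ↦ max (a i) (‖x i‖ + δ))
      fun i ↦ ⟨le_max_left _ _, max_le (hab i) (hx i).le⟩)
    rw [setLIntegral_bump hδ, mul_one, inv_volume_pi_ball x fun i ↦ lt_max_of_lt_left (ha i)]
    · simp only [truncKernel, hx, if_true]
    · refine pi_mono fun i _ ↦ ball_subset_ball' ?_
      rw [dist_zero_left, add_comm]
      exact le_max_right _ _
  · push Not at hx
    obtain ⟨i, hi⟩ := hx
    rw [Finset.prod_eq_zero (Finset.mem_univ i) (by rw [truncKernel, if_neg hi.not_gt])]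
    simp

end Maximal

/-- For every `ε > 0` there is `f ∈ L¹(ℝⁿ)` of norm one with
`‖M̃_a^b f‖₁ ≥ ∏ᵢ (1 + nᵢ·ln(bᵢ/aᵢ)) − ε`; consequently the `L¹` operator norm of
`M̃_a^b` equals `∏ᵢ (1 + nᵢ·ln(bᵢ/aᵢ))`. -/
theorem genTruncMax_l1_norm (k : ℕ) (hk : 1 ≤ k) (n : Fin k → ℕ) (hn : ∀ i, 1 ≤ n i)
    (a b : Fin k → ℝ) (ha : ∀ i, 0 < a i) (hab : ∀ i, a i ≤ b i) :
    (∀ ε : ℝ, 0 < ε → ∃ f : (∀ i, EuclideanSpace ℝ (Fin (n i))) → ℝ,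
      Integrable f ∧ (∫⁻ x, (‖f x‖₊ : ℝ≥0∞)) = 1 ∧
        ENNReal.ofReal ((∏ i, (1 + (n i : ℝ) * Real.log (b i / a i))) - ε) ≤
          ∫⁻ x, genTruncMax k n a b f x) ∧
    (⨆ (f : (∀ i, EuclideanSpace ℝ (Fin (n i))) → ℝ)
        (_ : Integrable f ∧ (∫⁻ x, (‖f x‖₊ : ℝ≥0∞)) = 1),
        ∫⁻ x, genTruncMax k n a b f x)
      = ENNReal.ofReal (∏ i, (1 + (n i : ℝ) * Real.log (b i / a i))) := by
  have hker (i) : ∫ z, truncKernel (n i) (a i) (b i) 0 z = 1 + n i * Real.log (b i / a i) :=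
    integral_truncKernel_zero (hn i) (ha i) (hab i)
  have hlower : ∀ ε : ℝ, 0 < ε → ∃ f : (∀ i, EuclideanSpace ℝ (Fin (n i))) → ℝ,
      Integrable f ∧ (∫⁻ x, (‖f x‖₊ : ℝ≥0∞)) = 1 ∧
        ENNReal.ofReal ((∏ i, (1 + (n i : ℝ) * Real.log (b i / a i))) - ε) ≤
          ∫⁻ x, genTruncMax k n a b f x := by
    intro ε hε
    have hlim := tendsto_finsetProd Finset.univ fun i _ ↦
      tendsto_integral_truncKernel (d := n i) (b := b i) (ha i)
    simp_rw [hker] at hlim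
    obtain ⟨δ, hδε, hδ⟩ :=
      ((hlim.eventually_const_lt (sub_lt_self _ hε)).and self_mem_nhdsWithin).exists
    refine ⟨bump n δ, integrable_bump δ, ?_, ?_⟩
    · rw [← setLIntegral_univ, setLIntegral_bump hδ (subset_univ _)]
    · calc _ ≤ ENNReal.ofReal (∏ i, ∫ z, truncKernel (n i) (a i) (b i) δ z) :=
            ENNReal.ofReal_le_ofReal hδε.le
        _ = _ := (lintegral_prod_truncKernel ha hδ.le).symm
        _ ≤ _ := lintegral_mono (le_genTruncMax_bump ha hab hδ)
  refine ⟨hlower, le_antisymm (iSup₂_le fun f hf ↦ ?_) ?_⟩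
  · simpa only [hker, hf.2, mul_one] using lintegral_genTruncMax_le (b := b) ha hf.1
  · refine ENNReal.le_of_forall_pos_le_add fun ε hε _ ↦ ?_
    obtain ⟨f, hfi, hf1, hf⟩ := hlower ε hε
    calc _ = ENNReal.ofReal ((∏ i, (1 + (n i : ℝ) * Real.log (b i / a i))) - ε + ε) := by
          rw [sub_add_cancel]
      _ ≤ _ := ENNReal.ofReal_add_le
      _ ≤ _ := by
          rw [ENNReal.ofReal_coe_nnreal]
          gcongr
          exact hf.trans (le_iSup₂ (f := fun f _ ↦ ∫⁻ x, genTruncMax k n a b f x) f ⟨hfi, hf1⟩)
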